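/- arXiv:0809.2406 — 3 statements merged into one kernel-verified Lean document; each statement's English description precedes it below -/
import Mathlib

section
/- For every real r with 0 < r ≤ 1 and every s ∈ [0,1], one has 2r² + (1−r²)²·s·(1−s) ≥ 2r²·(1 − (1−r²)·s)², with equality when s = 0. -/
/-- For `0 < r ≤ 1` and `s ∈ [0,1]`,
`2r² + (1−r²)²·s·(1−s) ≥ 2r²·(1 − (1−r²)·s)²`, with equality when `s = 0`. -/
theorem key_inequality_small_r (r : ℝ) (hr0 : 0 < r) (hr1 : r ≤ 1)
    (s : ℝ) (hs0 : 0 ≤ s) (hs1 : s ≤ 1) :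
    2 * r ^ 2 + (1 - r ^ 2) ^ 2 * s * (1 - s)
      ≥ 2 * r ^ 2 * (1 - (1 - r ^ 2) * s) ^ 2 ∧
    (s = 0 →
      2 * r ^ 2 + (1 - r ^ 2) ^ 2 * s * (1 - s)
        = 2 * r ^ 2 * (1 - (1 - r ^ 2) * s) ^ 2) := by
  refine ⟨?_, fun h => by rw [h]; ring⟩
  have ha0 : 0 ≤ 1 - r ^ 2 := by nlinarith
  have has : 0 ≤ (1 - r ^ 2) * s := mul_nonneg ha0 hs0
  have has2 : 0 ≤ 2 - (1 - r ^ 2) * s := by nlinarith [sq_nonneg r]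
  have h1 : 0 ≤ 2 * r ^ 2 * ((1 - r ^ 2) * s * (2 - (1 - r ^ 2) * s)) := by positivity
  have h2 : 0 ≤ (1 - r ^ 2) ^ 2 * s * (1 - s) :=
    mul_nonneg (by positivity) (sub_nonneg.2 hs1)
  linear_combination h1 + h2
end

section
/- For every real r with r ≥ 1 and every s ∈ [0,1], one has r²·(2r² + (1−r²)²·s·(1−s)) ≥ 2·(1 − (1−r²)·s)², with equality when s = 1. -/
/-- For `r ≥ 1` and `s ∈ [0,1]`,
`r²·(2r² + (1−r²)²·s·(1−s)) ≥ 2·(1 − (1−r²)·s)²`, with equality when `s = 1`. -/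
theorem key_inequality_large_r (r : ℝ) (hr : 1 ≤ r)
    (s : ℝ) (hs0 : 0 ≤ s) (hs1 : s ≤ 1) :
    r ^ 2 * (2 * r ^ 2 + (1 - r ^ 2) ^ 2 * s * (1 - s))
      ≥ 2 * (1 - (1 - r ^ 2) * s) ^ 2 ∧
    (s = 1 →
      r ^ 2 * (2 * r ^ 2 + (1 - r ^ 2) ^ 2 * s * (1 - s))
        = 2 * (1 - (1 - r ^ 2) * s) ^ 2) := by
  have hk : 0 ≤ r ^ 2 - 1 := sub_nonneg.mpr (one_le_pow₀ hr)
  have hs : 0 ≤ 1 - s := sub_nonneg.mpr hs1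
  have hks : 0 ≤ (r ^ 2 - 1) * s := mul_nonneg hk hs0
  refine ⟨?_, fun h => by subst h; ring⟩
  have factor_nonneg : 0 ≤ (r ^ 2 - 1) * (1 - s) *
      (2 * (r ^ 2 + 1 + (r ^ 2 - 1) * s) + r ^ 2 * ((r ^ 2 - 1) * s)) := by
    positivity
  linear_combination factor_nonneg
end

section
/- Let g : ℝ → ℝ be a differentiable function with g(t) > 0 for all t and g(t + 2π) = g(t) for all t, and let λ ∈ ℝ. Then there exists a differentiable, 2π-periodic function ψ : ℝ → ℂ, not identically zero, satisfying i·ψ′(t) + i·(g′(t)/(2·g(t)))·ψ(t) = λ·ψ(t) for all t ∈ ℝ, if and only if λ ∈ ℤ. In particular, the set of such λ equals ℤ and does not depend on g. -/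
/-- The square root of a positive differentiable function, as a complex-valued integrating factor. -/
theorem hasDerivAt_ofReal_sqrt_comp {g : ℝ → ℝ} {t : ℝ} (hg : DifferentiableAt ℝ g t)
    (hpos : 0 < g t) :
    HasDerivAt (fun t => ((√(g t) : ℝ) : ℂ))
      (((deriv g t / (2 * g t) : ℝ) : ℂ) * (√(g t) : ℝ)) t := by
  have h := (hg.hasDerivAt.sqrt hpos.ne').ofReal_comp
  refine h.congr_deriv ?_
  rw [← Complex.ofReal_mul]
  congr 1
  have hs : √(g t) ≠ 0 := (Real.sqrt_pos.2 hpos).ne'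
  have hg0 := hpos.ne'
  field_simp
  rw [Real.sq_sqrt hpos.le]

theorem hasDerivAt_cexp_mul_ofReal (c : ℂ) (t : ℝ) :
    HasDerivAt (fun t : ℝ => Complex.exp (c * t)) (Complex.exp (c * t) * c) t := by
  simpa using ((Complex.ofRealCLM.hasDerivAt (x := t)).const_mul c).cexp

/-- Multiplying a solution by `√g · exp (i lam t)` yields a constant function. -/
theorem sqrt_mul_mul_cexp_eq_of_solution {g : ℝ → ℝ} (hg : Differentiable ℝ g)
    (hgpos : ∀ t, 0 < g t) {lam : ℝ} {ψ : ℝ → ℂ} (hψ : Differentiable ℝ ψ)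
    (heq : ∀ t, Complex.I * deriv ψ t
      + Complex.I * ((deriv g t : ℝ) / (2 * g t) : ℝ) * ψ t = (lam : ℂ) * ψ t) (s t : ℝ) :
    (√(g s) : ℝ) * ψ s * Complex.exp (Complex.I * lam * s)
      = (√(g t) : ℝ) * ψ t * Complex.exp (Complex.I * lam * t) := by
  have key (t : ℝ) : HasDerivAt
      (fun t : ℝ => ((√(g t) : ℝ) : ℂ) * ψ t * Complex.exp (Complex.I * lam * t)) 0 t := by
    refine (((hasDerivAt_ofReal_sqrt_comp (hg t) (hgpos t)).fun_mul (hψ t).hasDerivAt).fun_mul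
      (hasDerivAt_cexp_mul_ofReal (Complex.I * lam) t)).congr_deriv ?_
    linear_combination
      -((√(g t) : ℝ) : ℂ) * Complex.exp (Complex.I * lam * t) * Complex.I * heq t
      + ((√(g t) : ℝ) : ℂ) * Complex.exp (Complex.I * lam * t) *
        (deriv ψ t + ((deriv g t / (2 * g t) : ℝ) : ℂ) * ψ t) * Complex.I_mul_I
  exact is_const_of_deriv_eq_zero (fun t => (key t).differentiableAt) (fun t => (key t).deriv) s t

theorem exists_int_eq_of_solution {g : ℝ → ℝ} (hg : Differentiable ℝ g)
    (hgpos : ∀ t, 0 < g t) (hgper : ∀ t, g (t + 2 * Real.pi) = g t) {lam : ℝ} {ψ : ℝ → ℂ}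
    (hψ : Differentiable ℝ ψ) (hψper : ∀ t, ψ (t + 2 * Real.pi) = ψ t) (hne : ∃ t, ψ t ≠ 0)
    (heq : ∀ t, Complex.I * deriv ψ t
      + Complex.I * ((deriv g t : ℝ) / (2 * g t) : ℝ) * ψ t = (lam : ℂ) * ψ t) :
    ∃ k : ℤ, lam = (k : ℝ) := by
  obtain ⟨t, ht⟩ := hne
  have h := sqrt_mul_mul_cexp_eq_of_solution hg hgpos hψ heq (t + 2 * Real.pi) t
  have hs : ((√(g t) : ℝ) : ℂ) ≠ 0 := Complex.ofReal_ne_zero.2 (Real.sqrt_pos.2 (hgpos t)).ne'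
  rw [hgper, hψper] at h
  obtain ⟨k, hk⟩ := Complex.exp_eq_exp_iff_exists_int.1 (mul_left_cancel₀ (mul_ne_zero hs ht) h)
  refine ⟨k, ?_⟩
  have h2 : (2 * Real.pi * Complex.I : ℂ) ≠ 0 := Complex.two_pi_I_ne_zero
  have h3 : (lam : ℂ) = k := by
    apply mul_right_cancel₀ h2
    push_cast at hk
    linear_combination hk
  exact_mod_cast h3

theorem exists_solution_of_int {g : ℝ → ℝ} (hg : Differentiable ℝ g)
    (hgpos : ∀ t, 0 < g t) (hgper : ∀ t, g (t + 2 * Real.pi) = g t) (k : ℤ) :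
    ∃ ψ : ℝ → ℂ, Differentiable ℝ ψ ∧ (∀ t, ψ (t + 2 * Real.pi) = ψ t) ∧ (∃ t, ψ t ≠ 0) ∧
      (∀ t, Complex.I * deriv ψ t
        + Complex.I * ((deriv g t : ℝ) / (2 * g t) : ℝ) * ψ t = ((k : ℝ) : ℂ) * ψ t) := by
  have hs (t : ℝ) : ((√(g t) : ℝ) : ℂ) ≠ 0 :=
    Complex.ofReal_ne_zero.2 (Real.sqrt_pos.2 (hgpos t)).ne'
  have hd (t : ℝ) := (hasDerivAt_cexp_mul_ofReal (-(Complex.I * k)) t).fun_div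
    (hasDerivAt_ofReal_sqrt_comp (hg t) (hgpos t)) (hs t)
  refine ⟨fun t => Complex.exp (-(Complex.I * k) * t) / (√(g t) : ℝ),
    fun t => (hd t).differentiableAt, fun t => ?_,
    ⟨0, div_ne_zero (Complex.exp_ne_zero _) (hs 0)⟩, fun t => ?_⟩
  · simp only [hgper]
    congr 1
    refine Complex.exp_eq_exp_iff_exists_int.2 ⟨-k, ?_⟩
    push_cast
    ring
  · rw [(hd t).deriv]
    have := hs t
    generalize ((deriv g t / (2 * g t) : ℝ) : ℂ) = a
    field_simp
    push_cast
    linear_combination (-(k : ℂ)) * Complex.I_sq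

/-- For `g : ℝ → ℝ` differentiable, positive and `2π`-periodic, a nontrivial
differentiable `2π`-periodic solution `ψ` of `i·ψ′ + i·(g′/(2g))·ψ = λ·ψ` exists
if and only if `λ ∈ ℤ`; in particular the set of such `λ` equals `ℤ` and does
not depend on `g`. -/
theorem spectrum_eq_integers (g : ℝ → ℝ) (hg : Differentiable ℝ g)
    (hgpos : ∀ t, 0 < g t) (hgper : ∀ t, g (t + 2 * Real.pi) = g t) :
    (∀ lam : ℝ,
      (∃ ψ : ℝ → ℂ, Differentiable ℝ ψ ∧ (∀ t, ψ (t + 2 * Real.pi) = ψ t) ∧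
        (∃ t, ψ t ≠ 0) ∧
        (∀ t, Complex.I * deriv ψ t
            + Complex.I * ((deriv g t : ℝ) / (2 * g t) : ℝ) * ψ t = (lam : ℂ) * ψ t))
      ↔ ∃ k : ℤ, lam = (k : ℝ)) ∧
    { lam : ℝ | ∃ ψ : ℝ → ℂ, Differentiable ℝ ψ ∧ (∀ t, ψ (t + 2 * Real.pi) = ψ t) ∧
        (∃ t, ψ t ≠ 0) ∧
        (∀ t, Complex.I * deriv ψ t
            + Complex.I * ((deriv g t : ℝ) / (2 * g t) : ℝ) * ψ t = (lam : ℂ) * ψ t) }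
      = Set.range ((↑) : ℤ → ℝ) := by
  have main (lam : ℝ) :
      (∃ ψ : ℝ → ℂ, Differentiable ℝ ψ ∧ (∀ t, ψ (t + 2 * Real.pi) = ψ t) ∧
        (∃ t, ψ t ≠ 0) ∧
        (∀ t, Complex.I * deriv ψ t
            + Complex.I * ((deriv g t : ℝ) / (2 * g t) : ℝ) * ψ t = (lam : ℂ) * ψ t))
      ↔ ∃ k : ℤ, lam = (k : ℝ) := by
    constructor
    · rintro ⟨ψ, hψ, hψper, hne, heq⟩
      exact exists_int_eq_of_solution hg hgpos hgper hψ hψper hne heq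
    · rintro ⟨k, rfl⟩
      exact exists_solution_of_int hg hgpos hgper k
  refine ⟨main, Set.ext fun lam => (main lam).trans ?_⟩
  simp only [Set.mem_range, eq_comm]
end
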